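/- Regard second-order three-dimensional complex matrices as families A = (A_{ijk}) with i,j,k ∈ {1,2}, with the ternary product (A⊙B⊙C)_{ijk} = Σ_{l,m,n} A_{ijl} B_{nml} C_{mnk} and associated ternary commutator [A,B,C] = A⊙B⊙C + ω·B⊙C⊙A + ω̄·C⊙A⊙B + C⊙B⊙A + ω̄·B⊙A⊙C + ω·A⊙C⊙B. Call A traceless if for every k ∈ {1,2} one has Σᵢ A_{iik} = Σᵢ A_{iki} = Σᵢ A_{kii} = 0. Then the traceless second-order three-dimensional matrices are closed under the ternary commutator: if A, B, C are traceless, so is [A,B,C]. -/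

import Mathlib

open Finset

/-- The primitive cube root of unity `ω = exp(2πi/3)`. -/
noncomputable def ω : ℂ := Complex.exp (2 * Real.pi * Complex.I / 3)

/-- Its complex conjugate `ω̄`. -/
noncomputable def ωb : ℂ := (starRingEnd ℂ) ω

/-- The ternary product `(A ⊙ B ⊙ C)_{ijk} = Σ_{l,m,n} A_{ijl} B_{nml} C_{mnk}` of
second-order three-dimensional complex matrices. -/
noncomputable def tprod3 (A B C : Fin 2 → Fin 2 → Fin 2 → ℂ) :
    Fin 2 → Fin 2 → Fin 2 → ℂ :=
  fun i j k => ∑ l, ∑ m, ∑ n, A i j l * B n m l * C m n k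

/-- The associated ternary commutator of three-dimensional matrices. -/
noncomputable def tcomm3 (A B C : Fin 2 → Fin 2 → Fin 2 → ℂ) :
    Fin 2 → Fin 2 → Fin 2 → ℂ :=
  tprod3 A B C + ω • tprod3 B C A + ωb • tprod3 C A B
    + tprod3 C B A + ωb • tprod3 B A C + ω • tprod3 A C B

/-- A three-dimensional matrix is traceless if its trace with respect to every pair
of subscripts vanishes. -/
def Traceless (A : Fin 2 → Fin 2 → Fin 2 → ℂ) : Prop :=
  ∀ k : Fin 2, (∑ i, A i i k = 0) ∧ (∑ i, A i k i = 0) ∧ (∑ i, A k i i = 0)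

/-- The conjugate cube root of unity satisfies `ω̄ = -1 - ω`. -/
theorem ωb_eq : ωb = -1 - ω := by
  have h : (2 * Real.pi * Complex.I / 3 : ℂ) = ((2 * Real.pi / 3 : ℝ) : ℂ) * Complex.I := by
    push_cast; ring
  have hcos : Real.cos (2 * Real.pi / 3) = -1 / 2 := by
    rw [show 2 * Real.pi / 3 = Real.pi - Real.pi / 3 by ring, Real.cos_pi_sub,
      Real.cos_pi_div_three]
    norm_num
  apply Complex.ext
  · simp only [ωb, ω, h, Complex.conj_re, Complex.sub_re, Complex.neg_re, Complex.one_re,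
      Complex.exp_ofReal_mul_I_re, hcos]
    norm_num
  · simp [ωb, ω]

/-- The entries of a traceless matrix of order 2 are determined by `A 0 0 0` and `A 1 1 1`. -/
theorem Traceless.entries {A : Fin 2 → Fin 2 → Fin 2 → ℂ} (hA : Traceless A) :
    A 1 1 0 = -A 0 0 0 ∧ A 1 0 1 = -A 0 0 0 ∧ A 0 1 1 = -A 0 0 0 ∧
      A 0 0 1 = -A 1 1 1 ∧ A 0 1 0 = -A 1 1 1 ∧ A 1 0 0 = -A 1 1 1 := by
  obtain ⟨h₁, h₂, h₃⟩ := hA 0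
  obtain ⟨h₄, h₅, h₆⟩ := hA 1
  simp only [Fin.sum_univ_two] at h₁ h₂ h₃ h₄ h₅ h₆
  exact ⟨by linear_combination h₁, by linear_combination h₂, by linear_combination h₃,
    by linear_combination h₄, by linear_combination h₅, by linear_combination h₆⟩

/-- traceless second-order three-dimensional matrices are closed under
the ternary commutator. -/
theorem traceless_closed_under_tcomm3 (A B C : Fin 2 → Fin 2 → Fin 2 → ℂ)
    (hA : Traceless A) (hB : Traceless B) (hC : Traceless C) :
    Traceless (tcomm3 A B C) := by
  obtain ⟨a₁, a₂, a₃, a₄, a₅, a₆⟩ := hA.entries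
  obtain ⟨b₁, b₂, b₃, b₄, b₅, b₆⟩ := hB.entries
  obtain ⟨c₁, c₂, c₃, c₄, c₅, c₆⟩ := hC.entries
  intro k
  fin_cases k <;> refine ⟨?_, ?_, ?_⟩ <;>
    simp only [tcomm3, tprod3, Pi.add_apply, Pi.smul_apply, smul_eq_mul, Fin.sum_univ_two,
      Fin.zero_eta, Fin.mk_one, a₁, a₂, a₃, a₄, a₅, a₆, b₁, b₂, b₃, b₄, b₅, b₆,
      c₁, c₂, c₃, c₄, c₅, c₆, ωb_eq] <;>
    ring
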